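/- Let λ ∈ F_{q^n} \ F_q, let t = [F_q(λ):F_q], and let S = ⟨1, λ, …, λ^{k−1}⟩_{F_q} with t/2 < k < t. Then the code C = Orb(S) ⊆ G_q(n,k) satisfies: ω_{2i}(C) = (q+1)·q^{2i−1} for every i ∈ {1,…,t−k−1}; ω_{2(t−k)}(C) = (q^t − q^{2(t−k)−1})/(q−1); ω_{2i}(C) = 0 for every i ∈ {t−k+1,…,k−1} (when this range is nonempty); and ω_{2k}(C) = (q^n − q^t)/(q−1). -/

import Mathlib

/-!
Setting: `q` is a prime power, realized by a finite field `Fq` with `Fintype.card Fq = q`;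
`F` plays the role of `F_{q^n}`: a finite field extension of `Fq` with `Module.finrank Fq F = n`.
`F_q`-subspaces of `F_{q^n}` are `Submodule Fq F`; for a divisor `t` of `n`, the subfield
`F_{q^t}` is the (unique) `T : IntermediateField Fq F` with `Module.finrank Fq ↥T = t`, and
`F_{q^t}`-subspaces are `Submodule ↥T F`.
-/

set_option synthInstance.maxHeartbeats 1000000

namespace FWS

variable (R : Type*) {F : Type*} [Field R] [Field F] [Algebra R F]

/-- The cyclic shift `α S = {α * s : s ∈ S}` of an `R`-subspace `S` of `F`. -/
def shift (α : F) (S : Submodule R F) : Submodule R F :=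
  S.map (LinearMap.mulLeft R α)

/-- The subspace distance `d(U,V) = dim U + dim V - 2 dim (U ⊓ V)`
(which is `2k - 2 dim (U ⊓ V)` for `U, V` of the same dimension `k`). -/
noncomputable def sdist (U V : Submodule R F) : ℕ :=
  Module.finrank R ↥U + Module.finrank R ↥V - 2 * Module.finrank R ↥(U ⊓ V)

/-- The one-orbit cyclic subspace code `Orb(S) = {α S : α ∈ F*}`. -/
def orb (S : Submodule R F) : Set (Submodule R F) :=
  {T | ∃ α : F, α ≠ 0 ∧ T = shift R α S}

/-- The weight `ω_{2i}(Orb(S)) = #{α S : α ∈ F*, d(S, α S) = 2 i}`. -/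
noncomputable def omega (S : Submodule R F) (i : ℕ) : ℕ :=
  Nat.card {T : Submodule R F // T ∈ orb R S ∧ sdist R S T = 2 * i}

/-- `Orb(S)` is a full weight spectrum (FWS) code: `ω_{2i} > 0` for all `1 ≤ i ≤ dim S`. -/
def IsFWS (S : Submodule R F) : Prop :=
  ∀ i : ℕ, 1 ≤ i → i ≤ Module.finrank R ↥S → 0 < omega R S i

/-- The subspace `⟨1, l, ..., l^(k-1)⟩_R` spanned by the first `k` powers of `l`. -/
def polySpan (l : F) (k : ℕ) : Submodule R F :=
  Submodule.span R ((fun i : ℕ => l ^ i) '' Set.Iio k)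

/-- The invariant `m(Orb(S))`: the least divisor `t` of `n` such that
`dim_{F_{q^t}} ⟨S⟩_{F_{q^t}} = 1` (equivalently, the degree of the smallest subfield
containing a cyclic shift of `S`). -/
noncomputable def mOrb (S : Submodule R F) : ℕ :=
  sInf {t : ℕ | t ∣ Module.finrank R F ∧
    ∃ T : IntermediateField R F, Module.finrank R ↥T = t ∧
      Module.finrank ↥T ↥(Submodule.span ↥T (S : Set F)) = 1}

/-- The stabilizer `H(S) = {x ∈ F* : x S = S} ∪ {0}` of a set `S ⊆ F`, as a subset of `F`
(it is a subfield of `F` when `S` is a subspace). -/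
def stab {F : Type*} [Field F] (S : Set F) : Set F :=
  {x : F | x ≠ 0 ∧ (fun y => x * y) '' S = S} ∪ {0}

end FWS

open FWS

namespace FWS

open Polynomial Module

section Shift

variable {K F : Type*} [Field K] [Field F] [Algebra K F]

theorem mem_shift {α x : F} {S : Submodule K F} : x ∈ shift K α S ↔ ∃ s ∈ S, α * s = x := by
  simp [shift]

theorem finrank_shift {α : F} (hα : α ≠ 0) (S : Submodule K F) :
    finrank K ↥(shift K α S) = finrank K ↥S :=
  (LinearEquiv.finrank_eq (Submodule.equivMapOfInjective (LinearMap.mulLeft K α)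
    (mul_right_injective₀ hα) S)).symm

theorem shift_shift (α β : F) (S : Submodule K F) :
    shift K α (shift K β S) = shift K (α * β) S := by
  ext x
  simp only [mem_shift]
  constructor
  · rintro ⟨_, ⟨s, hs, rfl⟩, rfl⟩
    exact ⟨s, hs, by ring⟩
  · rintro ⟨s, hs, rfl⟩
    exact ⟨_, ⟨s, hs, rfl⟩, by ring⟩

theorem shift_one (S : Submodule K F) : shift K 1 S = S := by
  ext x
  simp [mem_shift]

theorem shift_algebraMap {c : K} (hc : c ≠ 0) (S : Submodule K F) :
    shift K (algebraMap K F c) S = S := by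
  ext x
  rw [mem_shift]
  constructor
  · rintro ⟨s, hs, rfl⟩
    rw [← Algebra.smul_def]
    exact S.smul_mem c hs
  · intro hx
    exact ⟨c⁻¹ • x, S.smul_mem _ hx, by rw [← Algebra.smul_def, smul_inv_smul₀ hc]⟩

/-- The dimension of the intersection of `S` with its cyclic shift `α S`. -/
noncomputable def interDim (S : Submodule K F) (α : F) : ℕ :=
  finrank K ↥(S ⊓ shift K α S)

theorem interDim_le [FiniteDimensional K F] (S : Submodule K F) (α : F) :
    interDim S α ≤ finrank K ↥S :=
  Submodule.finrank_mono inf_le_left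

theorem interDim_mono [FiniteDimensional K F] {S T : Submodule K F} (h : S ≤ T) (α : F) :
    interDim S α ≤ interDim T α :=
  Submodule.finrank_mono (inf_le_inf h (Submodule.map_mono h))

theorem exists_of_interDim_pos {S : Submodule K F} {α : F} (h : 0 < interDim S α) :
    ∃ x ∈ S, x ≠ 0 ∧ α * x ∈ S ∧ α * x ≠ 0 := by
  have hne : S ⊓ shift K α S ≠ ⊥ := by
    intro hb
    rw [interDim, hb, finrank_bot] at h
    exact h.false
  obtain ⟨y, ⟨hyS, hyT⟩, hy0⟩ := Submodule.exists_mem_ne_zero_of_ne_bot hne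
  obtain ⟨x, hx, rfl⟩ := mem_shift.1 hyT
  exact ⟨x, hx, right_ne_zero_of_mul hy0, hyS, hy0⟩

theorem interDim_pos [FiniteDimensional K F] {S : Submodule K F} {α x : F} (hα : α ≠ 0)
    (hx : x ∈ S) (hx0 : x ≠ 0) (hαx : α * x ∈ S) : 0 < interDim S α := by
  have hne : S ⊓ shift K α S ≠ ⊥ := fun hb =>
    mul_ne_zero hα hx0 ((Submodule.mem_bot K).1 (hb ▸ ⟨hαx, mem_shift.2 ⟨x, hx, rfl⟩⟩))
  have := Submodule.nontrivial_iff_ne_bot.2 hne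
  exact finrank_pos

theorem sdist_shift_eq_iff [FiniteDimensional K F] {S : Submodule K F} {α : F} (hα : α ≠ 0)
    (i : ℕ) : sdist K S (shift K α S) = 2 * i ↔ interDim S α + i = finrank K ↥S := by
  have h := interDim_le S α
  rw [sdist, finrank_shift hα]
  change _ - 2 * interDim S α = _ ↔ _
  omega

end Shift

section Counting

variable {K F : Type*} [Field K] [Field F] [Algebra K F] [Fintype K] [Fintype F]

open scoped Classical in
theorem sum_pow_interDim_sub_one (S : Submodule K F) :
    ∑ α : F with α ≠ 0, ((Fintype.card K : ℤ) ^ interDim S α - 1) =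
      ((Fintype.card K : ℤ) ^ finrank K ↥S - 1) ^ 2 := by
  have hcard (T : Submodule K F) :
      ((Finset.univ.filter (fun x : F => x ∈ T ∧ x ≠ 0)).card : ℤ) =
        (Fintype.card K : ℤ) ^ finrank K ↥T - 1 := by
    have h1 : (Finset.univ.filter (fun x : F => x ∈ T)).card =
        Fintype.card K ^ finrank K ↥T := by
      rw [← Module.card_eq_pow_finrank (K := K) (V := T), Fintype.card_subtype]
    have h2 : Finset.univ.filter (fun x : F => x ∈ T ∧ x ≠ 0) =
        (Finset.univ.filter (fun x : F => x ∈ T)).erase 0 := by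
      ext x
      simp [and_comm]
    rw [h2, Finset.card_erase_of_mem (by simp), h1,
      Nat.cast_sub (Nat.one_le_pow _ _ Fintype.card_pos)]
    simp
  set A := Finset.univ.filter (fun x : F => x ∈ S ∧ x ≠ 0) with hA
  have hpairs : (A ×ˢ A).card = ∑ α : F with α ≠ 0,
      ((A ×ˢ A).filter (fun p => p.1 / p.2 = α)).card := by
    refine Finset.card_eq_sum_card_fiberwise fun p hp => ?_
    simp only [hA, Finset.coe_product, Set.mem_prod, Finset.mem_coe, Finset.mem_filter,
      Finset.mem_univ, true_and] at hp
    simp [hp.1.2, hp.2.2]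
  have hfib (α : F) (hα : α ≠ 0) : ((A ×ˢ A).filter (fun p => p.1 / p.2 = α)).card =
      (Finset.univ.filter (fun x : F => x ∈ S ⊓ shift K α S ∧ x ≠ 0)).card := by
    refine Finset.card_bij (fun p _ => p.1) ?_ ?_ ?_
    · rintro ⟨x, y⟩ hp
      simp only [hA, Finset.mem_filter, Finset.mem_product, Finset.mem_univ, true_and] at hp
      obtain ⟨⟨hx, hy⟩, rfl⟩ := hp
      simp only [Finset.mem_filter, Finset.mem_univ, true_and]
      exact ⟨⟨hx.1, mem_shift.2 ⟨y, hy.1, div_mul_cancel₀ _ hy.2⟩⟩, hx.2⟩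
    · rintro ⟨x, y⟩ hp ⟨x', y'⟩ hp' h
      simp only [hA, Finset.mem_filter, Finset.mem_product, Finset.mem_univ, true_and] at hp hp' h
      subst h
      have h1 := (div_eq_iff hp.1.2.2).1 hp.2
      have h2 := (div_eq_iff hp'.1.2.2).1 hp'.2
      rw [h1] at h2
      rw [mul_left_cancel₀ hα h2]
    · intro x hx
      simp only [Finset.mem_filter, Finset.mem_univ, true_and] at hx
      obtain ⟨⟨hxS, hxT⟩, hx0⟩ := hx
      obtain ⟨y, hy, rfl⟩ := mem_shift.1 hxT
      have hy0 := right_ne_zero_of_mul hx0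
      refine ⟨(α * y, y), ?_, rfl⟩
      simp only [hA, Finset.mem_filter, Finset.mem_product, Finset.mem_univ, true_and]
      exact ⟨⟨⟨hxS, hx0⟩, hy, hy0⟩, mul_div_cancel_right₀ _ hy0⟩
  have hA' := hcard S
  rw [← hA] at hA'
  rw [← hA', sq, ← Nat.cast_mul, ← Finset.card_product, hpairs, Nat.cast_sum]
  refine Finset.sum_congr rfl fun α hα => ?_
  rw [hfib α (by simpa using hα), hcard]
  rfl

open scoped Classical in
/-- If only the scalars stabilize `S`, every codeword comes from exactly `q - 1` multipliers. -/
theorem card_sub_one_mul_omega (S : Submodule K F)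
    (hstab : ∀ γ : F, γ ≠ 0 → shift K γ S = S → γ ∈ Set.range (algebraMap K F))
    (i : ℕ) :
    (Fintype.card K - 1) * omega K S i =
      (Finset.univ.filter (fun α : F => α ≠ 0 ∧ interDim S α + i = finrank K ↥S)).card := by
  set A := Finset.univ.filter (fun α : F => α ≠ 0 ∧ interDim S α + i = finrank K ↥S) with hA
  have homega : omega K S i = (A.image (fun α => shift K α S)).card := by
    refine Nat.subtype_card _ fun T => ?_
    simp only [hA, Finset.mem_image, Finset.mem_filter, Finset.mem_univ, true_and, orb,
      Set.mem_ofPred_eq]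
    constructor
    · rintro ⟨α, ⟨hα, hi⟩, rfl⟩
      exact ⟨⟨α, hα, rfl⟩, (sdist_shift_eq_iff hα i).2 hi⟩
    · rintro ⟨⟨α, hα, rfl⟩, hi⟩
      exact ⟨α, ⟨hα, (sdist_shift_eq_iff hα i).1 hi⟩, rfl⟩
  have hfib : ∀ T ∈ A.image (fun α => shift K α S),
      (A.filter (fun α => shift K α S = T)).card = Fintype.card K - 1 := by
    intro T hT
    obtain ⟨α, hα, rfl⟩ := Finset.mem_image.1 hT
    simp only [hA, Finset.mem_filter, Finset.mem_univ, true_and] at hα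
    rw [← Fintype.card_units, ← Finset.card_univ]
    symm
    refine Finset.card_bij (fun c _ => algebraMap K F c * α) ?_ ?_ ?_
    · intro c _
      have hshift : shift K (algebraMap K F c * α) S = shift K α S := by
        rw [mul_comm, ← shift_shift, shift_algebraMap c.ne_zero]
      have hdim : interDim S (algebraMap K F c * α) = interDim S α := by
        rw [interDim, hshift, interDim]
      simp only [hA, Finset.mem_filter, Finset.mem_univ, true_and, hdim]
      exact ⟨⟨mul_ne_zero (by simp) hα.1, hα.2⟩, hshift⟩
    · intro c _ c' _ h
      exact Units.ext ((algebraMap K F).injective (mul_right_cancel₀ hα.1 h))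
    · intro β hβ
      simp only [hA, Finset.mem_filter, Finset.mem_univ, true_and] at hβ
      obtain ⟨⟨hβ0, -⟩, hβS⟩ := hβ
      obtain ⟨c, hc⟩ := hstab (α⁻¹ * β) (mul_ne_zero (inv_ne_zero hα.1) hβ0) (by
        rw [← shift_shift, hβS, shift_shift, inv_mul_cancel₀ hα.1, shift_one])
      have hc0 : c ≠ 0 := by
        rintro rfl
        rw [map_zero] at hc
        exact mul_ne_zero (inv_ne_zero hα.1) hβ0 hc.symm
      refine ⟨Units.mk0 c hc0, Finset.mem_univ _, ?_⟩
      rw [Units.val_mk0, hc]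
      field_simp [hα.1]
  rw [Finset.card_eq_sum_card_image (fun α => shift K α S) A, Finset.sum_congr rfl hfib, homega,
    Finset.sum_const, smul_eq_mul, mul_comm]

end Counting
section PolySpan

variable {K F : Type*} [Field K] [Field F] [Algebra K F] {l α : F} {r k : ℕ}

theorem degree_mul_lt_natCast_iff {a f : K[X]} (ha : a ≠ 0) :
    (a * f).degree < (r : WithBot ℕ) ↔ f = 0 ∨ a.natDegree + f.natDegree < r := by
  rcases eq_or_ne f 0 with rfl | hf
  · simp
  · rw [degree_eq_natDegree (mul_ne_zero ha hf), natDegree_mul ha hf, Nat.cast_lt]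
    simp [hf]

theorem degree_lt_natCast_iff {f : K[X]} :
    f.degree < (r : WithBot ℕ) ↔ f = 0 ∨ f.natDegree < r := by
  simpa using degree_mul_lt_natCast_iff (r := r) (f := f) (one_ne_zero : (1 : K[X]) ≠ 0)

theorem polySpan_eq_map (l : F) (r : ℕ) :
    polySpan K l r = (degreeLT K r).map (aeval l).toLinearMap := by
  classical
  rw [degreeLT_eq_span_X_pow, Submodule.map_span, polySpan]
  congr 1
  ext x
  simp

theorem mem_polySpan {x : F} :
    x ∈ polySpan K l r ↔ ∃ f : K[X], f.degree < r ∧ aeval l f = x := by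
  simp [polySpan_eq_map, mem_degreeLT]

theorem polySpan_mono {s : ℕ} (h : r ≤ s) : polySpan K l r ≤ polySpan K l s :=
  Submodule.span_mono (Set.image_mono (Set.Iio_subset_Iio h))

theorem exists_isCoprime_of_interDim_pos (h : 0 < interDim (polySpan K l r) α) :
    ∃ a b : K[X], IsCoprime a b ∧ a ≠ 0 ∧ b ≠ 0 ∧ a.natDegree < r ∧ b.natDegree < r ∧
      α * aeval l b = aeval l a := by
  classical
  obtain ⟨x, hx, hx0, hαx, hαx0⟩ := exists_of_interDim_pos h
  obtain ⟨B, hB, rfl⟩ := mem_polySpan.1 hx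
  obtain ⟨A, hA, hAB⟩ := mem_polySpan.1 hαx
  rw [← hAB] at hαx0
  have hA0 : A ≠ 0 := fun h => hαx0 (by rw [h, map_zero])
  have hB0 : B ≠ 0 := fun h => hx0 (by rw [h, map_zero])
  let := EuclideanDomain.gcdMonoid K[X]
  obtain ⟨a, b, ha, hb, hab⟩ := extract_gcd A B
  set G := gcd A B
  have hG0 : aeval l G ≠ 0 := fun h0 => hαx0 (by rw [ha, map_mul, h0, zero_mul])
  have ha0 : a ≠ 0 := fun h0 => hA0 (by rw [ha, h0, mul_zero])
  have hb0 : b ≠ 0 := fun h0 => hB0 (by rw [hb, h0, mul_zero])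
  have hG : G ≠ 0 := fun h0 => hG0 (by rw [h0, map_zero])
  rw [ha, degree_mul_lt_natCast_iff hG] at hA
  rw [hb, degree_mul_lt_natCast_iff hG] at hB
  have hA' := hA.resolve_left ha0
  have hB' := hB.resolve_left hb0
  refine ⟨a, b, (gcd_isUnit_iff a b).1 hab, ha0, hb0, by omega, by omega, ?_⟩
  rw [ha, hb, map_mul, map_mul] at hAB
  refine mul_left_cancel₀ hG0 ?_
  rw [hAB]
  ring

variable [FiniteDimensional K F]

theorem eq_zero_of_aeval_eq_zero {f : K[X]} (hf : f.degree < ((minpoly K l).natDegree : ℕ))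
    (h : aeval l f = 0) : f = 0 := by
  by_contra h0
  have h1 := minpoly.degree_le_of_ne_zero K l h0 h
  rw [degree_eq_natDegree (minpoly.ne_zero (IsIntegral.of_finite K l))] at h1
  exact absurd hf h1.not_gt

theorem finrank_map_mul_aeval {a : K[X]} (ha : a ≠ 0)
    (h : a.natDegree + r ≤ (minpoly K l).natDegree) :
    finrank K ↥((degreeLT K r).map
      ((aeval l).toLinearMap ∘ₗ LinearMap.mulLeft K a : K[X] →ₗ[K] F)) = r := by
  set φ : K[X] →ₗ[K] F := (aeval l).toLinearMap ∘ₗ LinearMap.mulLeft K a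
  have hinj : Function.Injective (φ.domRestrict (degreeLT K r)) := by
    rw [← LinearMap.ker_eq_bot, LinearMap.ker_eq_bot']
    rintro ⟨f, hf⟩ h0
    rw [mem_degreeLT] at hf
    have h1 : a * f = 0 := by
      refine eq_zero_of_aeval_eq_zero (l := l) ?_ h0
      rw [degree_mul_lt_natCast_iff ha]
      exact (degree_lt_natCast_iff.1 hf).imp_right fun hf => by omega
    exact Subtype.ext ((mul_eq_zero.1 h1).resolve_left ha)
  rw [← LinearMap.range_domRestrict, LinearMap.finrank_range_of_inj hinj,
    (degreeLTEquiv K r).finrank_eq, finrank_fin_fun]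

theorem finrank_polySpan (h : r ≤ (minpoly K l).natDegree) :
    finrank K ↥(polySpan K l r) = r := by
  have := finrank_map_mul_aeval (K := K) (l := l) (r := r) one_ne_zero (by simpa using h)
  rwa [LinearMap.mulLeft_one, LinearMap.comp_id, ← polySpan_eq_map] at this

theorem polySpan_natDegree_minpoly (l : F) :
    polySpan K l (minpoly K l).natDegree =
      Subalgebra.toSubmodule (IntermediateField.adjoin K {l}).toSubalgebra := by
  refine Submodule.eq_of_le_of_finrank_eq ?_ ?_
  · rw [polySpan, Submodule.span_le]
    rintro _ ⟨i, -, rfl⟩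
    exact pow_mem (IntermediateField.mem_adjoin_simple_self K l) i
  · rw [finrank_polySpan le_rfl]
    exact (IntermediateField.adjoin.finrank (IsIntegral.of_finite K l)).symm

theorem mem_polySpan_natDegree_minpoly {x : F} :
    x ∈ polySpan K l (minpoly K l).natDegree ↔ x ∈ IntermediateField.adjoin K {l} := by
  rw [polySpan_natDegree_minpoly]
  rfl

theorem mem_adjoin_of_mem_polySpan {x : F} (hr : r ≤ (minpoly K l).natDegree)
    (hx : x ∈ polySpan K l r) : x ∈ IntermediateField.adjoin K {l} :=
  mem_polySpan_natDegree_minpoly.1 (polySpan_mono hr hx)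

theorem mem_adjoin_of_interDim_pos (hr : r ≤ (minpoly K l).natDegree)
    (h : 0 < interDim (polySpan K l r) α) : α ∈ IntermediateField.adjoin K {l} := by
  obtain ⟨x, hx, hx0, hαx, -⟩ := exists_of_interDim_pos h
  rw [← mul_div_cancel_right₀ α hx0]
  exact div_mem (mem_adjoin_of_mem_polySpan hr hαx) (mem_adjoin_of_mem_polySpan hr hx)

theorem interDim_polySpan_eq {a b : K[X]} (hab : IsCoprime a b) (ha : a ≠ 0) (hb : b ≠ 0)
    (hα : α * aeval l b = aeval l a)
    (hr : r + max a.natDegree b.natDegree ≤ (minpoly K l).natDegree) :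
    interDim (polySpan K l r) α = r - max a.natDegree b.natDegree := by
  suffices hinter : polySpan K l r ⊓ shift K α (polySpan K l r) =
      (degreeLT K (r - max a.natDegree b.natDegree)).map
        ((aeval l).toLinearMap ∘ₗ LinearMap.mulLeft K a) by
    rw [interDim, hinter, finrank_map_mul_aeval ha (by omega)]
  ext x
  simp only [Submodule.mem_inf, mem_shift, Submodule.mem_map, mem_degreeLT, LinearMap.comp_apply,
    LinearMap.mulLeft_apply, AlgHom.toLinearMap_apply, mem_polySpan]
  constructor
  · rintro ⟨⟨f, hf, rfl⟩, _, ⟨g, hg, rfl⟩, hfg⟩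
    have h0 : b * f - a * g = 0 := by
      refine eq_zero_of_aeval_eq_zero (l := l) ?_ ?_
      · refine (degree_sub_le _ _).trans_lt (max_lt ?_ ?_)
        · rw [degree_mul_lt_natCast_iff hb]
          exact (degree_lt_natCast_iff.1 hf).imp_right fun hf => by omega
        · rw [degree_mul_lt_natCast_iff ha]
          exact (degree_lt_natCast_iff.1 hg).imp_right fun hg => by omega
      · rw [map_sub, map_mul, map_mul, ← hfg, ← hα]
        ring
    have h1 : b * f = a * g := sub_eq_zero.1 h0
    obtain ⟨h, rfl⟩ := hab.dvd_of_dvd_mul_left ⟨g, h1⟩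
    refine ⟨h, ?_, rfl⟩
    have h2 : g = b * h := mul_left_cancel₀ ha (by rw [← h1]; ring)
    subst h2
    rw [degree_mul_lt_natCast_iff ha] at hf
    rw [degree_mul_lt_natCast_iff hb] at hg
    rw [degree_lt_natCast_iff]
    exact hf.elim Or.inl fun hf => hg.imp_right fun hg => by omega
  · rintro ⟨h, hh, rfl⟩
    refine ⟨⟨a * h, ?_, rfl⟩, _, ⟨b * h, ?_, rfl⟩, ?_⟩
    · rw [degree_mul_lt_natCast_iff ha]
      exact (degree_lt_natCast_iff.1 hh).imp_right fun hh => by omega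
    · rw [degree_mul_lt_natCast_iff hb]
      exact (degree_lt_natCast_iff.1 hh).imp_right fun hh => by omega
    · rw [map_mul, map_mul, ← hα, mul_assoc]

/-- Two polynomials in `l` of small degree with ratio `α` exist as soon as `S ∩ α S` exceeds its
generic dimension: this is the orthogonality of `⟨1, …, l^(k-1)⟩` and `⟨1, …, l^(t-k-1)⟩` under the
bilinear form reading off the coefficient of `l^(t-1)`. -/
theorem interDim_pos_of_lt (hα : α ≠ 0) (hαT : α ∈ IntermediateField.adjoin K {l})
    (hk : k ≤ (minpoly K l).natDegree)
    (h : 2 * k < (minpoly K l).natDegree + interDim (polySpan K l k) α) :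
    0 < interDim (polySpan K l ((minpoly K l).natDegree - k)) α := by
  set t := (minpoly K l).natDegree with ht
  set S := polySpan K l k with hS
  set W := S ⊔ shift K α S with hW
  have ht0 : 0 < t := minpoly.natDegree_pos (IsIntegral.of_finite K l)
  have hWdim : finrank K ↥W < finrank K ↥(polySpan K l t) := by
    have h1 := Submodule.finrank_sup_add_finrank_inf_eq S (shift K α S)
    rw [finrank_shift hα, hS, finrank_polySpan hk] at h1
    rw [finrank_polySpan ht.le]
    change finrank K ↥W + interDim S α = k + k at h1
    omega
  have hlast : l ^ (t - 1) ∉ polySpan K l (t - 1) := by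
    intro hmem
    obtain ⟨f, hf, hfl⟩ := mem_polySpan.1 hmem
    have h0 : X ^ (t - 1) - f = 0 := by
      refine eq_zero_of_aeval_eq_zero (l := l) ?_ (by simp [hfl])
      rw [degree_sub_eq_left_of_degree_lt (by simpa using hf), degree_X_pow, Nat.cast_lt]
      omega
    rw [← sub_eq_zero.1 h0, degree_X_pow] at hf
    exact hf.false
  obtain ⟨φ, hφ, hφ0⟩ := Submodule.exists_le_ker_of_notMem hlast
  have hφdeg (f : K[X]) (hf0 : f ≠ 0) (hf : f.natDegree = t - 1) : φ (aeval l f) ≠ 0 := by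
    have h1 : φ (aeval l f.eraseLead) = 0 := by
      refine hφ0 (mem_polySpan.2 ⟨_, ?_, rfl⟩)
      rw [← hf, ← degree_eq_natDegree hf0]
      exact degree_eraseLead_lt hf0
    rw [← eraseLead_add_C_mul_X_pow f, map_add, map_add, h1, zero_add, hf, map_mul, aeval_C,
      ← Algebra.smul_def, map_smul, map_pow, aeval_X]
    exact smul_ne_zero (leadingCoeff_ne_zero.2 hf0) hφ
  let B : ↥(polySpan K l t) →ₗ[K] Module.Dual K ↥W :=
    (((LinearMap.mul K F).compr₂ φ).domRestrict₁₂ (polySpan K l t) W)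
  have hker : LinearMap.ker B ≠ ⊥ :=
    LinearMap.ker_ne_bot_of_finrank_lt (by rwa [Subspace.dual_finrank_eq])
  obtain ⟨⟨y, hyt⟩, hyB, hy0⟩ := Submodule.exists_mem_ne_zero_of_ne_bot hker
  have hyW (w : F) (hw : w ∈ W) : φ (y * w) = 0 :=
    LinearMap.congr_fun (LinearMap.mem_ker.1 hyB) ⟨w, hw⟩
  have hy0' : y ≠ 0 := fun h0 => hy0 (Subtype.ext h0)
  have key (z : F) (hzt : z ∈ polySpan K l t) (hz : ∀ s ∈ S, φ (z * s) = 0) :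
      z ∈ polySpan K l (t - k) := by
    obtain ⟨f, hf, rfl⟩ := mem_polySpan.1 hzt
    refine mem_polySpan.2 ⟨f, ?_, rfl⟩
    by_contra! hdeg
    have hf0 : f ≠ 0 := by
      rintro rfl
      simp at hdeg
    rw [degree_eq_natDegree hf0, Nat.cast_lt] at hf
    rw [degree_eq_natDegree hf0, Nat.cast_le] at hdeg
    refine hφdeg (f * X ^ (t - 1 - f.natDegree)) (mul_ne_zero hf0 (pow_ne_zero _ X_ne_zero)) ?_ ?_
    · rw [natDegree_mul_X_pow _ hf0]
      omega
    · rw [map_mul]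
      refine hz _ (mem_polySpan.2 ⟨_, ?_, rfl⟩)
      rw [degree_X_pow, Nat.cast_lt]
      omega
  refine interDim_pos hα (key y hyt fun s hs => hyW s (Submodule.mem_sup_left hs)) hy0'
    (key _ ?_ fun s hs => ?_)
  · rw [mem_polySpan_natDegree_minpoly] at hyt ⊢
    exact mul_mem hαT hyt
  · rw [mul_comm α y, mul_assoc]
    exact hyW _ (Submodule.mem_sup_right (mem_shift.2 ⟨s, hs, rfl⟩))

/-- Writing `α` as a reduced fraction in `l` of degree `m - interDim (polySpan K l m) α`, every
further multiplication by `l` enlarges `S ∩ α S` by one dimension. -/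
theorem interDim_polySpan_add {m : ℕ} (hrm : r + m ≤ (minpoly K l).natDegree + 1)
    (hm : 2 * m ≤ (minpoly K l).natDegree + 1) (h : 0 < interDim (polySpan K l m) α) :
    interDim (polySpan K l r) α = r - (m - interDim (polySpan K l m) α) := by
  obtain ⟨a, b, hab, ha, hb, ham, hbm, hα⟩ := exists_isCoprime_of_interDim_pos h
  rw [interDim_polySpan_eq hab ha hb hα (by omega), interDim_polySpan_eq hab ha hb hα (by omega)]
  omega

theorem interDim_polySpan_of_le {m : ℕ} (hrm : r ≤ m) (hm : 2 * m ≤ (minpoly K l).natDegree + 1) :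
    interDim (polySpan K l r) α = r - (m - interDim (polySpan K l m) α) := by
  rcases Nat.eq_zero_or_pos (interDim (polySpan K l m) α) with h | h
  · have := interDim_mono (polySpan_mono (K := K) (l := l) hrm) α
    omega
  · exact interDim_polySpan_add (by omega) hm h

/-- For `k` beyond half of the degree `t` of `l`, the dimension of `S ∩ α S` exceeds its generic
value `2k - t` by its value for the complementary exponent `t - k`. -/
theorem interDim_polySpan_large (hα : α ≠ 0) (hαT : α ∈ IntermediateField.adjoin K {l})
    (hk1 : (minpoly K l).natDegree < 2 * k) (hk2 : k < (minpoly K l).natDegree) :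
    interDim (polySpan K l k) α + (minpoly K l).natDegree =
      2 * k + interDim (polySpan K l ((minpoly K l).natDegree - k)) α := by
  set t := (minpoly K l).natDegree with ht
  have hlow : 2 * k ≤ interDim (polySpan K l k) α + t := by
    have h1 := Submodule.finrank_sup_add_finrank_inf_eq (polySpan K l k)
      (shift K α (polySpan K l k))
    rw [finrank_shift hα, finrank_polySpan hk2.le] at h1
    have h2 : polySpan K l k ⊔ shift K α (polySpan K l k) ≤ polySpan K l t := by
      refine sup_le (polySpan_mono hk2.le) ?_
      intro x hx
      obtain ⟨s, hs, rfl⟩ := mem_shift.1 hx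
      exact mem_polySpan_natDegree_minpoly.2
        (mul_mem hαT (mem_adjoin_of_mem_polySpan hk2.le hs))
    have h3 := Submodule.finrank_mono h2
    rw [finrank_polySpan ht.le] at h3
    change _ + interDim (polySpan K l k) α = _ at h1
    omega
  rcases Nat.eq_zero_or_pos (interDim (polySpan K l (t - k)) α) with h | h
  · have := mt (interDim_pos_of_lt hα hαT hk2.le) (by rw [← ht, h]; exact lt_irrefl 0)
    omega
  · have h1 := interDim_polySpan_add (r := k) (by omega) (by omega) h
    have h2 := interDim_le (polySpan K l (t - k)) α
    rw [finrank_polySpan (by omega)] at h2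
    omega

theorem mem_range_algebraMap_of_shift_eq (hk1 : 0 < k) (hk2 : k < (minpoly K l).natDegree)
    (h : shift K α (polySpan K l k) = polySpan K l k) : α ∈ Set.range (algebraMap K F) := by
  have hmem (i : ℕ) (hi : i < k) : α * l ^ i ∈ polySpan K l k := by
    rw [← h]
    exact mem_shift.2 ⟨_, Submodule.subset_span ⟨i, hi, rfl⟩, rfl⟩
  obtain ⟨f, hf, hfα⟩ := mem_polySpan.1 (hmem 0 hk1)
  rw [pow_zero, mul_one] at hfα
  rcases Nat.eq_zero_or_pos f.natDegree with h0 | h0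
  · rw [eq_C_of_natDegree_eq_zero h0, aeval_C] at hfα
    exact ⟨_, hfα⟩
  exfalso
  have hf0 : f ≠ 0 := by
    rintro rfl
    simp at h0
  have hfk := (degree_lt_natCast_iff.1 hf).resolve_left hf0
  obtain ⟨g, hg, hgα⟩ := mem_polySpan.1 (hmem (k - f.natDegree) (by omega))
  have hdeg : (f * X ^ (k - f.natDegree)).degree = (k : WithBot ℕ) := by
    rw [degree_mul, degree_X_pow, degree_eq_natDegree hf0, ← Nat.cast_add]
    congr 1
    omega
  have hsub : f * X ^ (k - f.natDegree) - g = 0 := by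
    refine eq_zero_of_aeval_eq_zero (l := l) ?_ (by simp [hfα, hgα])
    rw [degree_sub_eq_left_of_degree_lt (by rwa [hdeg]), hdeg, Nat.cast_lt]
    exact hk2
  rw [← sub_eq_zero.1 hsub, hdeg] at hg
  exact hg.false

end PolySpan

section PolySpanCounting

variable {K F : Type*} [Field K] [Field F] [Algebra K F] [Fintype K] [Fintype F] {l : F}

open scoped Classical in
/-- The number of nonzero fractions in `l` of degree at most `r`. -/
theorem card_lt_interDim_add {m r : ℕ} (hm : 2 * m ≤ (minpoly K l).natDegree) (hr : r < m) :
    ((Finset.univ.filter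
      (fun α : F => α ≠ 0 ∧ m < interDim (polySpan K l m) α + (r + 1))).card : ℤ) =
      (Fintype.card K : ℤ) ^ (2 * r + 1) - 1 := by
  have : FiniteDimensional K F := Module.Finite.of_finite
  have hsum (s : ℕ) (hs : s ≤ m) := sum_pow_interDim_sub_one (polySpan K l s)
  have hq : ((Fintype.card K : ℤ) - 1) ≠ 0 := by
    have : 1 < Fintype.card K := Fintype.one_lt_card
    omega
  set q : ℤ := (Fintype.card K : ℤ)
  have h1 := hsum r hr.le
  have h2 := hsum (r + 1) hr
  rw [finrank_polySpan (by omega)] at h1 h2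
  have hpt (α : F) : q ^ interDim (polySpan K l (r + 1)) α - 1 =
      q * (q ^ interDim (polySpan K l r) α - 1) +
        (q - 1) * (if m < interDim (polySpan K l m) α + (r + 1) then 1 else 0) := by
    rw [interDim_polySpan_of_le (r := r + 1) (m := m) hr (by omega),
      interDim_polySpan_of_le (r := r) (m := m) hr.le (by omega)]
    split_ifs with h
    · rw [Nat.sub_add_comm (by omega), pow_succ]
      ring
    · rw [Nat.sub_eq_zero_of_le (by omega), Nat.sub_eq_zero_of_le (by omega)]
      ring
  rw [Finset.sum_congr rfl fun α _ => hpt α, Finset.sum_add_distrib, ← Finset.mul_sum,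
    ← Finset.mul_sum, h1, Finset.sum_boole, Finset.filter_filter] at h2
  refine mul_left_cancel₀ hq ?_
  linear_combination h2

theorem card_filter_add_card_filter {ι : Type*} [Fintype ι] {P Q R : ι → Prop}
    [DecidablePred P] [DecidablePred Q] [DecidablePred R]
    (hR : ∀ x, R x ↔ P x ∨ Q x) (hPQ : ∀ x, P x → ¬ Q x) :
    (Finset.univ.filter P).card + (Finset.univ.filter Q).card =
      (Finset.univ.filter R).card := by
  classical
  rw [← Finset.card_union_of_disjoint (Finset.disjoint_filter.2 fun x _ => hPQ x),
    ← Finset.filter_or]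
  simp only [hR]

open scoped Classical in
theorem card_mem_intermediateField_ne_zero (T : IntermediateField K F) :
    ((Finset.univ.filter (fun α : F => α ≠ 0 ∧ α ∈ T)).card : ℤ) =
      (Fintype.card K : ℤ) ^ finrank K ↥T - 1 := by
  have h1 := card_filter_add_card_filter (P := fun α : F => α ≠ 0 ∧ α ∈ T) (Q := fun α => α = 0)
    (R := fun α => α ∈ T)
    (fun α => ⟨fun h => (eq_or_ne α 0).elim Or.inr fun h0 => Or.inl ⟨h0, h⟩,
      fun h => h.elim And.right fun h0 => h0 ▸ T.zero_mem⟩)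
    (fun α h => h.1)
  have h2 : (Finset.univ.filter (fun α : F => α ∈ T)).card = Fintype.card K ^ finrank K ↥T := by
    rw [← Module.card_eq_pow_finrank (K := K) (V := ↥T), Fintype.card_subtype]
  have h3 : (Finset.univ.filter (fun α : F => α = 0)).card = 1 :=
    Finset.card_eq_one.2 ⟨0, by ext; simp⟩
  rw [h2, h3] at h1
  rw [eq_sub_iff_add_eq]
  exact_mod_cast h1

end PolySpanCounting

end FWS

/-- Theorem 4.4, case `t/2 < k < t`: the weight distribution of the code
generated by `S = ⟨1, λ, …, λ^(k-1)⟩_{F_q}` with `t = [F_q(λ):F_q]` and `t/2 < k < t`. -/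
theorem weight_distribution_polySpan_large
    {Fq F : Type*} [Field Fq] [Field F] [Algebra Fq F] [Fintype Fq] [Fintype F]
    (q n : ℕ) (hq : Fintype.card Fq = q) (hn : Module.finrank Fq F = n)
    (lam : F) (hlam : lam ∉ Set.range (algebraMap Fq F))
    (t : ℕ) (ht : Module.finrank Fq ↥(IntermediateField.adjoin Fq {lam}) = t)
    (k : ℕ) (hk1 : t < 2 * k) (hk2 : k < t)
    (S : Submodule Fq F) (hS : S = polySpan Fq lam k) :
    (∀ i : ℕ, 1 ≤ i → i ≤ t - k - 1 → omega Fq S i = (q + 1) * q ^ (2 * i - 1)) ∧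
    (q - 1) * omega Fq S (t - k) = q ^ t - q ^ (2 * (t - k) - 1) ∧
    (∀ i : ℕ, t - k + 1 ≤ i → i ≤ k - 1 → omega Fq S i = 0) ∧
    (q - 1) * omega Fq S k = q ^ n - q ^ t := by
  classical
  have : FiniteDimensional Fq F := Module.Finite.of_finite
  have hadj := ht
  rw [IntermediateField.adjoin.finrank (IsIntegral.of_finite Fq lam)] at ht
  set T := IntermediateField.adjoin Fq {lam} with hT
  have hdim : Module.finrank Fq ↥S = k := by rw [hS, finrank_polySpan (by omega)]
  have homega := card_sub_one_mul_omega S (fun γ _ h =>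
    mem_range_algebraMap_of_shift_eq (by omega) (by omega) (hS ▸ h))
  rw [hq, hdim] at homega
  set m := t - k with hm
  have hin (α : F) (hα : α ≠ 0) (hαT : α ∈ T) :
      interDim S α + t = 2 * k + interDim (polySpan Fq lam m) α := by
    rw [hS, hm, ← ht]
    exact interDim_polySpan_large hα hαT (by omega) (by omega)
  have hout (α : F) (hαT : α ∉ T) :
      interDim S α = 0 ∧ interDim (polySpan Fq lam m) α = 0 := by
    rw [hS]
    exact ⟨Nat.eq_zero_of_not_pos (mt (mem_adjoin_of_interDim_pos (by omega)) hαT),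
      Nat.eq_zero_of_not_pos (mt (mem_adjoin_of_interDim_pos (by omega)) hαT)⟩
  have hcases (α : F) (hα : α ≠ 0) :
      α ∈ T ∧ interDim S α + t = 2 * k + interDim (polySpan Fq lam m) α ∨
        α ∉ T ∧ interDim S α = 0 ∧ interDim (polySpan Fq lam m) α = 0 := by
    by_cases hαT : α ∈ T
    · exact Or.inl ⟨hαT, hin α hα hαT⟩
    · exact Or.inr ⟨hαT, hout α hαT⟩
  have hle (α : F) : interDim (polySpan Fq lam m) α ≤ m := by
    have := interDim_le (polySpan Fq lam m) α
    rwa [finrank_polySpan (by omega)] at this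
  have hlow (r : ℕ) (hr : r < m) := card_lt_interDim_add (K := Fq) (l := lam) (m := m) (by omega) hr
  have hcardT := card_mem_intermediateField_ne_zero T
  have hcardF : ((Finset.univ.filter (fun α : F => α ≠ 0)).card : ℤ) = (q : ℤ) ^ n - 1 := by
    have := card_mem_intermediateField_ne_zero (K := Fq) (⊤ : IntermediateField Fq F)
    rw [IntermediateField.finrank_top', hn, hq] at this
    simpa using this
  rw [hq, hadj] at hcardT
  rw [hq] at hlow
  have hq1 : 1 < q := hq ▸ Fintype.one_lt_card
  have hpow {a b : ℕ} (h : a ≤ b) : q ^ a ≤ q ^ b := Nat.pow_le_pow_right (by omega) h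
  refine ⟨fun i hi1 hi2 => ?_, ?_, fun i hi1 hi2 => ?_, ?_⟩
  · have hsplit := card_filter_add_card_filter
      (P := fun α : F => α ≠ 0 ∧ interDim S α + i = k)
      (Q := fun α : F => α ≠ 0 ∧ m < interDim (polySpan Fq lam m) α + (i - 1 + 1))
      (R := fun α : F => α ≠ 0 ∧ m < interDim (polySpan Fq lam m) α + (i + 1))
      (fun α => by
        rw [← and_or_left]
        refine and_congr_right fun hα => ?_
        have := hcases α hα
        omega)
      (fun α h => by
        rw [not_and]
        intro hα
        have := hcases α hα
        have := h.2
        omega)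
    have h1 := hlow i (by omega)
    have h2 := hlow (i - 1) (by omega)
    rw [← homega i] at hsplit
    obtain ⟨j, rfl⟩ : ∃ j, i = j + 1 := ⟨i - 1, by omega⟩
    rw [← hsplit, Nat.cast_add, h2] at h1
    have hq0 : (q : ℤ) - 1 ≠ 0 := by omega
    push_cast [Nat.cast_sub hq1.le] at h1
    zify
    refine mul_left_cancel₀ hq0 ?_
    rw [show 2 * (j + 1) - 1 = 2 * j + 1 by omega]
    linear_combination h1
  · have hsplit := card_filter_add_card_filter
      (P := fun α : F => α ≠ 0 ∧ interDim S α + m = k)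
      (Q := fun α : F => α ≠ 0 ∧ m < interDim (polySpan Fq lam m) α + (m - 1 + 1))
      (R := fun α : F => α ≠ 0 ∧ α ∈ T)
      (fun α => by
        rw [← and_or_left]
        refine and_congr_right fun hα => ?_
        rcases hcases α hα with h | h <;> simp only [h.1, true_iff, false_iff] <;> omega)
      (fun α h => by
        rw [not_and]
        intro hα
        have := hcases α hα
        have := h.2
        omega)
    have h1 := hlow (m - 1) (by omega)
    rw [← homega m] at hsplit
    rw [← hsplit, Nat.cast_add, h1, show 2 * (m - 1) + 1 = 2 * m - 1 by omega] at hcardT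
    have := hpow (show 2 * m - 1 ≤ t by omega)
    rw [Nat.cast_mul] at hcardT
    zify [this]
    linear_combination hcardT
  · have h := homega i
    rw [Finset.filter_eq_empty_iff.2, Finset.card_empty, Nat.mul_eq_zero] at h
    · exact h.resolve_left (by omega)
    · rintro α - ⟨hα, h⟩
      have := hcases α hα
      omega
  · have hsplit := card_filter_add_card_filter
      (P := fun α : F => α ≠ 0 ∧ interDim S α + k = k)
      (Q := fun α : F => α ≠ 0 ∧ α ∈ T)
      (R := fun α : F => α ≠ 0)
      (fun α => by
        rw [← and_or_left, iff_self_and]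
        intro hα
        rcases hcases α hα with h | h
        · exact Or.inr h.1
        · exact Or.inl (by omega))
      (fun α h => by
        rw [not_and]
        intro hα hαT
        have := hin α hα hαT
        have := h.2
        omega)
    rw [← homega k] at hsplit
    rw [← hsplit, Nat.cast_add, hcardT] at hcardF
    have := hpow (show t ≤ n by
      rw [← hn, ← hadj]
      exact Submodule.finrank_le (Subalgebra.toSubmodule T.toSubalgebra))
    rw [Nat.cast_mul] at hcardF
    zify [this]
    linear_combination hcardF
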